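/- arXiv:2209.08383 — 3 statements merged into one kernel-verified Lean document; each statement's English description precedes it below -/
import Mathlib

section
/- Forward Refinement Relation: Let N be an NFA with vertex type V, and let L be a partition of V such that the member of L containing the starting vertex v₀ is the singleton {v₀}, and such that L is forward-stable. Then the equivalence relation induced by L (v ≈ w iff v and w lie in the same member of L) refines forward-equivalence: v ≈ w implies v ∼fwd w. -/
/-- An NFA with accepting actions: vertices `V`, alphabet `A` (edge labels in
`Option A`, with `none` the ε-label), accepting actions `T` with a conflict
relation, starting vertex, edge relation, and accepting-action assignment. -/
structure NFAA (V A T : Type*) where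
  start : V
  edge : V → Option A → V → Prop
  conf : T → T → Prop
  act : V → Set T

variable {V A T : Type*}

/-- `w` is reachable from `v` on the sequence `τ`. -/
def NFAA.ReachFrom (N : NFAA V A T) : V → List (Option A) → V → Prop
  | v, [], w => v = w
  | v, σ :: τ, w => ∃ u : V, N.edge v σ u ∧ N.ReachFrom u τ w

/-- `w` is reachable (from the starting vertex) on the sequence `τ`. -/
def NFAA.Reach (N : NFAA V A T) (τ : List (Option A)) (w : V) : Prop :=
  N.ReachFrom N.start τ w

/-- A conflict: two sequences with equal strings, reaching vertices carrying
conflicting actions. -/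
def NFAA.HasConflict (N : NFAA V A T) : Prop :=
  ∃ τ τ' : List (Option A), ∃ w w' : V, ∃ a a' : T,
    τ.filterMap id = τ'.filterMap id ∧
    N.Reach τ w ∧ N.Reach τ' w' ∧
    a ∈ N.act w ∧ a' ∈ N.act w' ∧ N.conf a a'

/-- The grouped NFA `N/∼` for an equivalence relation (setoid) `s` on `V`. -/
def NFAA.group (N : NFAA V A T) (s : Setoid V) : NFAA (Quotient s) A T where
  start := Quotient.mk s N.start
  edge c σ d := ∃ v w : V, Quotient.mk s v = c ∧ Quotient.mk s w = d ∧ N.edge v σ w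
  conf := N.conf
  act c := {a : T | ∃ v : V, Quotient.mk s v = c ∧ a ∈ N.act v}

/-- Forward equivalence: reachable from the start on exactly the same sequences. -/
def NFAA.FwdEquiv (N : NFAA V A T) (v₁ v₂ : V) : Prop :=
  ∀ τ : List (Option A), N.Reach τ v₁ ↔ N.Reach τ v₂

/-- Backward equivalence with respect to an initial partition `L0`. -/
def NFAA.BwdEquiv (N : NFAA V A T) (L0 : Set (Set V)) (v₁ v₂ : V) : Prop :=
  ∀ Z ∈ L0, ∀ τ : List (Option A),
    (∃ w ∈ Z, N.ReachFrom v₁ τ w) ↔ (∃ w ∈ Z, N.ReachFrom v₂ τ w)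

/-- A partition of `V`: pairwise disjoint nonempty subsets whose union is `V`. -/
def IsPartitionOf (L : Set (Set V)) : Prop :=
  (∀ Z ∈ L, Z.Nonempty) ∧
  (∀ Z ∈ L, ∀ Z' ∈ L, Z ≠ Z' → Z ∩ Z' = ∅) ∧
  ⋃₀ L = Set.univ

/-- `L` refines `L0`: every member of `L` is contained in some member of `L0`. -/
def RefinesPartition (L L0 : Set (Set V)) : Prop :=
  ∀ Y ∈ L, ∃ Z ∈ L0, Y ⊆ Z

/-- The forward image `Z[σ]`. -/
def NFAA.fwdImg (N : NFAA V A T) (Z : Set V) (σ : Option A) : Set V :=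
  {w : V | ∃ z ∈ Z, N.edge z σ w}

/-- The backward image `Z⁻[σ]`. -/
def NFAA.bwdImg (N : NFAA V A T) (Z : Set V) (σ : Option A) : Set V :=
  {z : V | ∃ w ∈ Z, N.edge z σ w}

/-- `L` is forward-stable. -/
def NFAA.FwdStable (N : NFAA V A T) (L : Set (Set V)) : Prop :=
  ∀ Z ∈ L, ∀ σ : Option A, ∀ Y ∈ L,
    Y ⊆ N.fwdImg Z σ ∨ Y ∩ N.fwdImg Z σ = ∅

/-- `L` is backward-stable. -/
def NFAA.BwdStable (N : NFAA V A T) (L : Set (Set V)) : Prop :=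
  ∀ Z ∈ L, ∀ σ : Option A, ∀ Y ∈ L,
    Y ⊆ N.bwdImg Z σ ∨ Y ∩ N.bwdImg Z σ = ∅

/-- `L0` is backward-admissible. -/
def NFAA.BwdAdmissible (N : NFAA V A T) (L0 : Set (Set V)) : Prop :=
  ∀ Z ∈ L0, ∀ Z' ∈ L0,
    (∃ w₁ ∈ Z, ∃ w₂ ∈ Z', ∃ a ∈ N.act w₁, ∃ a' ∈ N.act w₂, N.conf a a') →
    ∀ v₁ ∈ Z, ∀ v₂ ∈ Z', ∃ a ∈ N.act v₁, ∃ a' ∈ N.act v₂, N.conf a a'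

theorem NFAA.reachFrom_append_singleton (N : NFAA V A T) (τ : List (Option A))
    (σ : Option A) (v w : V) :
    N.ReachFrom v (τ ++ [σ]) w ↔ ∃ u, N.ReachFrom v τ u ∧ N.edge u σ w := by
  induction τ generalizing v with
  | nil => simp [NFAA.ReachFrom]
  | cons ρ τ ih =>
    simp only [List.cons_append, NFAA.ReachFrom, ih]
    constructor
    · rintro ⟨x, hx, u, hu, he⟩
      exact ⟨u, ⟨x, hx, hu⟩, he⟩
    · rintro ⟨u, ⟨x, hx, hu⟩, he⟩
      exact ⟨x, hx, u, hu, he⟩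

/-- Reachability is constant on the members of a forward-stable cover of the
vertices in which the start vertex is isolated. -/
theorem NFAA.FwdStable.reach_of_mem {N : NFAA V A T} {L : Set (Set V)}
    (hstable : N.FwdStable L) (hcover : ⋃₀ L = Set.univ)
    (hstart : ∀ Z ∈ L, N.start ∈ Z → Z = {N.start})
    {τ : List (Option A)} {Y : Set V} (hY : Y ∈ L) {v w : V} (hv : v ∈ Y) (hw : w ∈ Y)
    (h : N.Reach τ v) : N.Reach τ w := by
  induction τ using List.reverseRecOn generalizing Y v w with
  | nil =>
    obtain rfl : N.start = v := h
    rw [hstart Y hY hv] at hw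
    exact (Set.mem_singleton_iff.mp hw).symm
  | append_singleton τ σ ih =>
    obtain ⟨u, hu, he⟩ := (N.reachFrom_append_singleton τ σ _ v).mp h
    obtain ⟨Z, hZ, huZ⟩ := Set.mem_sUnion.mp (hcover ▸ Set.mem_univ u)
    have hvZ : v ∈ Y ∩ N.fwdImg Z σ := ⟨hv, u, huZ, he⟩
    rcases hstable Z hZ σ Y hY with hsub | hdisj
    · obtain ⟨z, hz, hzw⟩ := hsub hw
      exact (N.reachFrom_append_singleton τ σ _ w).mpr ⟨z, ih hZ huZ hz hu, hzw⟩
    · simp [hdisj] at hvZ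

/-- **Forward Refinement Relation.** The equivalence relation induced by a
forward-stable partition whose member containing the start vertex is the
singleton of the start vertex refines forward-equivalence. -/
theorem fwd_refinement_relation (N : NFAA V A T) (L : Set (Set V))
    (hpart : IsPartitionOf L)
    (hstart : ∀ Z ∈ L, N.start ∈ Z → Z = {N.start})
    (hstable : N.FwdStable L) :
    ∀ v w : V, (∃ Z ∈ L, v ∈ Z ∧ w ∈ Z) → N.FwdEquiv v w := by
  rintro v w ⟨Z, hZ, hv, hw⟩ τ
  exact ⟨hstable.reach_of_mem hpart.2.2 hstart hZ hv hw,
    hstable.reach_of_mem hpart.2.2 hstart hZ hw hv⟩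
end

section
/- Backward Refinement Relation: Let N be an NFA with vertex type V, let L0 be a partition of V, and let L be a partition of V that refines L0 and is backward-stable. Then the equivalence relation induced by L (v ≈ w iff v and w lie in the same member of L) refines backward-equivalence with respect to L0: v ≈ w implies v ∼bwd(L0) w. -/
variable {V A T : Type*}

/-- If `L` is a backward-stable cover and `v` and `w` share a block of `L`,
then `w` reaches on `τ` the same blocks of `L` as `v`. -/
theorem NFAA.BwdStable.exists_reachFrom {N : NFAA V A T} {L : Set (Set V)}
    (hcover : ⋃₀ L = Set.univ) (hstable : N.BwdStable L) (τ : List (Option A)) :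
    ∀ {v w x : V}, (∃ Y ∈ L, v ∈ Y ∧ w ∈ Y) → N.ReachFrom v τ x →
      ∃ y, (∃ Y ∈ L, x ∈ Y ∧ y ∈ Y) ∧ N.ReachFrom w τ y := by
  induction τ with
  | nil =>
    rintro v w x h rfl
    exact ⟨w, h, rfl⟩
  | cons σ τ ih =>
    rintro v w x ⟨Y, hY, hv, hw⟩ ⟨u, hvu, hux⟩
    obtain ⟨Z, hZ, hu⟩ : u ∈ ⋃₀ L := hcover ▸ Set.mem_univ u
    rcases hstable Z hZ σ Y hY with hsub | hdisj
    · obtain ⟨u', hu', hwu'⟩ := hsub hw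
      obtain ⟨y, hxy, hy⟩ := ih ⟨Z, hZ, hu, hu'⟩ hux
      exact ⟨y, hxy, u', hwu', hy⟩
    · exact (Set.eq_empty_iff_forall_notMem.mp hdisj v ⟨hv, u, hu, hvu⟩).elim

/-- If `L` refines a partition `L0`, elements sharing a block of `L` lie in the same blocks
of `L0`. -/
theorem RefinesPartition.mem_of_mem {L L0 : Set (Set V)} (hrefines : RefinesPartition L L0)
    (hpart0 : IsPartitionOf L0) {Z : Set V} (hZ : Z ∈ L0) {x y : V}
    (hxy : ∃ Y ∈ L, x ∈ Y ∧ y ∈ Y) (hx : x ∈ Z) : y ∈ Z := by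
  obtain ⟨Y, hY, hxY, hyY⟩ := hxy
  obtain ⟨Z', hZ', hsub⟩ := hrefines Y hY
  by_cases h : Z = Z'
  · exact h ▸ hsub hyY
  · exact (Set.eq_empty_iff_forall_notMem.mp (hpart0.2.1 Z hZ Z' hZ' h) x ⟨hx, hsub hxY⟩).elim

/-- **Backward Refinement Relation.** The equivalence relation induced by a
backward-stable partition `L` refining `L0` refines backward-equivalence
w.r.t. `L0`. -/
theorem bwd_refinement_relation (N : NFAA V A T) (L0 L : Set (Set V))
    (hpart0 : IsPartitionOf L0) (hpart : IsPartitionOf L)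
    (hrefines : RefinesPartition L L0) (hstable : N.BwdStable L) :
    ∀ v w : V, (∃ Y ∈ L, v ∈ Y ∧ w ∈ Y) → N.BwdEquiv L0 v w := by
  have key : ∀ v w : V, (∃ Y ∈ L, v ∈ Y ∧ w ∈ Y) → ∀ Z ∈ L0, ∀ τ : List (Option A),
      (∃ x ∈ Z, N.ReachFrom v τ x) → ∃ x ∈ Z, N.ReachFrom w τ x := by
    rintro v w hvw Z hZ τ ⟨x, hx, hvx⟩
    obtain ⟨y, hxy, hwy⟩ := hstable.exists_reachFrom hpart.2.2 τ hvw hvx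
    exact ⟨y, hrefines.mem_of_mem hpart0 hZ hxy hx, hwy⟩
  rintro v w ⟨Y, hY, hv, hw⟩ Z hZ τ
  exact ⟨key v w ⟨Y, hY, hv, hw⟩ Z hZ τ, key w v ⟨Y, hY, hw, hv⟩ Z hZ τ⟩
end

section
/- Forward partition grouping preserves conflicts: Let N be an NFA with vertex type V, and let L be a partition of V such that the member of L containing the starting vertex v₀ is the singleton {v₀}, and such that L is forward-stable. Let ≈ be the equivalence relation induced by L (v ≈ w iff v and w lie in the same member of L). Then the grouped NFA N/≈ has a conflict if and only if N has a conflict. -/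
variable {V A T : Type*}

/-- Reachability projects to the grouped NFA. -/
theorem NFAA.ReachFrom.group {N : NFAA V A T} (s : Setoid V) {τ : List (Option A)} {v w : V}
    (h : N.ReachFrom v τ w) :
    (N.group s).ReachFrom (Quotient.mk s v) τ (Quotient.mk s w) := by
  induction τ generalizing v with
  | nil => exact congrArg (Quotient.mk s) h
  | cons σ τ ih =>
    obtain ⟨u, hvu, huw⟩ := h
    exact ⟨Quotient.mk s u, ⟨v, u, rfl, rfl, hvu⟩, ih huw⟩

/-- An edge of the grouped NFA lifts to an edge into any prescribed vertex of the target class,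
when the partition is forward-stable. -/
theorem NFAA.FwdStable.exists_edge_of_group_edge {N : NFAA V A T} {L : Set (Set V)}
    (hpart : IsPartitionOf L) (hstable : N.FwdStable L) {s : Setoid V}
    (hs : ∀ v w : V, s.r v w ↔ ∃ Z ∈ L, v ∈ Z ∧ w ∈ Z) {c : Quotient s} {σ : Option A} {u : V}
    (h : (N.group s).edge c σ (Quotient.mk s u)) :
    ∃ v : V, Quotient.mk s v = c ∧ N.edge v σ u := by
  obtain ⟨v, w, rfl, hwu, hvw⟩ := h
  obtain ⟨Y, hY, hwY, huY⟩ := (hs w u).1 (Quotient.exact hwu)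
  obtain ⟨Z, hZ, hvZ⟩ : v ∈ ⋃₀ L := hpart.2.2 ▸ Set.mem_univ v
  have hw : w ∈ N.fwdImg Z σ := ⟨v, hvZ, hvw⟩
  rcases hstable Z hZ σ Y hY with hsub | hempty
  · obtain ⟨z, hzZ, hzu⟩ := hsub huY
    exact ⟨z, Quotient.sound ((hs z v).2 ⟨Z, hZ, hzZ, hvZ⟩), hzu⟩
  · exact (Set.eq_empty_iff_forall_notMem.1 hempty w ⟨hwY, hw⟩).elim

/-- A path in the grouped NFA lifts to a path ending at any prescribed vertex of the final class,
when the partition is forward-stable. -/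
theorem NFAA.FwdStable.exists_reachFrom_of_group_reachFrom {N : NFAA V A T} {L : Set (Set V)}
    (hpart : IsPartitionOf L) (hstable : N.FwdStable L) {s : Setoid V}
    (hs : ∀ v w : V, s.r v w ↔ ∃ Z ∈ L, v ∈ Z ∧ w ∈ Z) {c : Quotient s}
    {τ : List (Option A)} {w : V} (h : (N.group s).ReachFrom c τ (Quotient.mk s w)) :
    ∃ v : V, Quotient.mk s v = c ∧ N.ReachFrom v τ w := by
  induction τ generalizing c with
  | nil => exact ⟨w, h.symm, rfl⟩
  | cons σ τ ih =>
    obtain ⟨_, hedge, hreach⟩ := h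
    obtain ⟨u, rfl, huw⟩ := ih hreach
    obtain ⟨v, hv, hvu⟩ := hstable.exists_edge_of_group_edge hpart hs hedge
    exact ⟨v, hv, u, hvu, huw⟩

/-- **Forward partition grouping preserves conflicts.** Grouping by the
equivalence relation induced by a forward-stable partition whose member
containing the start vertex is the singleton of the start vertex preserves
the existence of conflicts. -/
theorem fwd_partition_grouping_preserves_conflicts (N : NFAA V A T)
    (L : Set (Set V)) (hpart : IsPartitionOf L)
    (hstart : ∀ Z ∈ L, N.start ∈ Z → Z = {N.start})
    (hstable : N.FwdStable L) (s : Setoid V)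
    (hs : ∀ v w : V, s.r v w ↔ ∃ Z ∈ L, v ∈ Z ∧ w ∈ Z) :
    (N.group s).HasConflict ↔ N.HasConflict := by
  have lift {τ : List (Option A)} {w : V} (h : (N.group s).Reach τ (Quotient.mk s w)) :
      N.Reach τ w := by
    obtain ⟨v, hv, hvw⟩ := hstable.exists_reachFrom_of_group_reachFrom hpart hs h
    obtain ⟨Z, hZ, hvZ, hstartZ⟩ := (hs v N.start).1 (Quotient.exact hv)
    obtain rfl : v = N.start := by simpa [hstart Z hZ hstartZ] using hvZ
    exact hvw
  constructor
  · rintro ⟨τ, τ', _, _, a, a', hτ, hw, hw', ⟨v, rfl, ha⟩, ⟨v', rfl, ha'⟩, hconf⟩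
    exact ⟨τ, τ', v, v', a, a', hτ, lift hw, lift hw', ha, ha', hconf⟩
  · rintro ⟨τ, τ', w, w', a, a', hτ, hw, hw', ha, ha', hconf⟩
    exact ⟨τ, τ', Quotient.mk s w, Quotient.mk s w', a, a', hτ, hw.group s, hw'.group s,
      ⟨w, rfl, ha⟩, ⟨w', rfl, ha'⟩, hconf⟩
end
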